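/- The spectral-parameter-dependent R-matrix R̄ of type C_n^{(1)} satisfies the unitarity condition: R̄_{21}(z)·R̄(z^{−1}) = R̄(z^{−1})·R̄_{21}(z) = Id, where R̄_{21}(z) = P·R̄(z)·P with P = Σ_{i,j=1}^{2n}E_{ij}⊗E_{ji} the permutation matrix and Id the 4n²×4n² identity matrix. -/

import Mathlib

noncomputable section

open Finset
open scoped Kronecker

set_option maxHeartbeats 1000000

abbrev K : Type := FractionRing (MvPolynomial (Fin 3) ℚ)

def ρ : K := algebraMap (MvPolynomial (Fin 3) ℚ) K (MvPolynomial.X 0)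
def σ' : K := algebraMap (MvPolynomial (Fin 3) ℚ) K (MvPolynomial.X 1)
def r : K := ρ ^ 2
def s : K := σ' ^ 2
def zVar : K := algebraMap (MvPolynomial (Fin 3) ℚ) K (MvPolynomial.X 2)

abbrev M (n : ℕ) := Matrix (Fin (2*n)) (Fin (2*n)) K
abbrev M2 (n : ℕ) := Matrix (Fin (2*n) × Fin (2*n)) (Fin (2*n) × Fin (2*n)) K

/-- the matrix unit `E_{kl}` (1-based indices). -/
def E (n k l : ℕ) : M n :=
  Matrix.of fun a b => if a.val + 1 = k ∧ b.val + 1 = l then (1 : K) else 0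

def eMat (n i : ℕ) : M n :=
  if i = n then (ρ⁻¹ * σ'⁻¹) • E n (n+1) n
  else (ρ⁻¹ * σ'⁻¹) • E n (i+1) i - E n (2*n-i+1) (2*n-i)

def fMat (n i : ℕ) : M n :=
  if i = n then (ρ⁻¹ * σ'⁻¹) • E n n (n+1)
  else (ρ⁻¹ * σ'⁻¹) • E n i (i+1) - E n (2*n-i) (2*n-i+1)

def ωMat (n i : ℕ) : M n :=
  if i = n then
    ∑ j ∈ Icc 1 (2*n),
      (if j ≤ n - 1 then r * s else if j = n then r⁻¹ * s else if j = n + 1 then r * s⁻¹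
       else r⁻¹ * s⁻¹) • E n j j
  else
    ∑ j ∈ Icc 1 (2*n),
      (if j = i then r⁻¹ else if j = i + 1 then s⁻¹ else if j = 2*n - i then s
       else if j = 2*n - i + 1 then r else 1) • E n j j

def ω'Mat (n i : ℕ) : M n :=
  if i = n then
    ∑ j ∈ Icc 1 (2*n),
      (if j ≤ n - 1 then r * s else if j = n then r * s⁻¹ else if j = n + 1 then r⁻¹ * s
       else r⁻¹ * s⁻¹) • E n j j
  else
    ∑ j ∈ Icc 1 (2*n),
      (if j = i then s⁻¹ else if j = i + 1 then r⁻¹ else if j = 2*n - i then r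
       else if j = 2*n - i + 1 then s else 1) • E n j j

/-- `ī` for `1 ≤ i ≤ 2n`. -/
def bar (n i : ℕ) : ℤ := if i ≤ n then (n : ℤ) + 1 - i else (n : ℤ) - i

/-- `ε_i` for `1 ≤ i ≤ 2n`. -/
def sg (n i : ℕ) : K := if i ≤ n then 1 else -1

def S1 (n : ℕ) : M2 n :=
  (∑ i ∈ Icc 1 (n-1), ∑ j ∈ Icc (i+1) n, E n i i ⊗ₖ E n j j)
  + (∑ i ∈ Icc 1 (n-1), ∑ j ∈ Icc (2*n+1-i+1) (2*n), E n i i ⊗ₖ E n j j)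
  + (∑ j ∈ Icc (n+2) (2*n), E n n n ⊗ₖ E n j j)
  + (∑ j ∈ Icc (n+1) (2*n-1), ∑ i ∈ Icc (j+1) (2*n), E n i i ⊗ₖ E n j j)
  + (∑ i ∈ Icc 1 (n-1), ∑ j ∈ Icc (n+1) (2*n-i), E n j j ⊗ₖ E n i i)

def S2 (n : ℕ) : M2 n :=
  (∑ i ∈ Icc 1 (n-1), ∑ j ∈ Icc (i+1) n, E n j j ⊗ₖ E n i i)
  + (∑ i ∈ Icc 1 (n-1), ∑ j ∈ Icc (2*n+1-i+1) (2*n), E n j j ⊗ₖ E n i i)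
  + (∑ j ∈ Icc (n+2) (2*n), E n j j ⊗ₖ E n n n)
  + (∑ j ∈ Icc (n+1) (2*n-1), ∑ i ∈ Icc (j+1) (2*n), E n j j ⊗ₖ E n i i)
  + (∑ i ∈ Icc 1 (n-1), ∑ j ∈ Icc (n+1) (2*n-i), E n i i ⊗ₖ E n j j)

/-- The basic quantum `R`-matrix of type `C_n`. -/
def RMat (n : ℕ) : M2 n :=
  (ρ * σ'⁻¹) • (∑ i ∈ Icc 1 (2*n), E n i i ⊗ₖ E n i i)
  + (ρ⁻¹ * σ') • (∑ i ∈ Icc 1 (2*n), E n i i ⊗ₖ E n (2*n+1-i) (2*n+1-i))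
  + (ρ * σ') • S1 n
  + (ρ⁻¹ * σ'⁻¹) • S2 n
  + (ρ * σ'⁻¹ - ρ⁻¹ * σ') •
      ((∑ i ∈ Icc 1 (2*n), ∑ j ∈ Icc (i+1) (2*n), E n i j ⊗ₖ E n j i)
        - ∑ i ∈ Icc 1 (2*n), ∑ j ∈ Icc 1 (i-1),
            ((ρ * σ'⁻¹) ^ (bar n i - bar n j) * sg n i * sg n j) •
              (E n (2*n+1-i) (2*n+1-j) ⊗ₖ E n i j))

/-- The permutation matrix `P`. -/
def Pmat (n : ℕ) : M2 n := ∑ i ∈ Icc 1 (2*n), ∑ j ∈ Icc 1 (2*n), E n i j ⊗ₖ E n j i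

def nExp (n : ℕ) : K := r ^ (-(n : ℤ) - 1) * s ^ ((n : ℤ) + 1)

/-- coefficients `a_{ij}(z)`. -/
def aC (n : ℕ) (z : K) (i j : ℕ) : K :=
  if i = j then (z - 1) * (r⁻¹ * s * z - nExp n)
  else if j < i then
    (r⁻¹ * s - 1) * z * ((ρ * σ'⁻¹) ^ (bar n i - bar n j) * sg n i * sg n j * (z - 1)
      - (if i = 2*n + 1 - j then 1 else 0) * (z - nExp n))
  else
    (r⁻¹ * s - 1) * ((ρ * σ'⁻¹) ^ (bar n i - bar n j) * sg n i * sg n j * nExp n * (z - 1)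
      - (if i = 2*n + 1 - j then 1 else 0) * (z - nExp n))

/-- The spectral-parameter-dependent `R`-matrix of type `C_n^{(1)}`. -/
def Rbar (n : ℕ) (z : K) : M2 n :=
  (∑ i ∈ Icc 1 (2*n), E n i i ⊗ₖ E n i i)
  + (r * s * (z - 1) / (z * r - s)) • S1 n
  + ((z - 1) / (z * r - s)) • S2 n
  + ((r - s) / (z * r - s)) •
      (∑ i ∈ Icc 1 (2*n), ∑ j ∈ Icc 1 (i-1), if i ≠ 2*n + 1 - j then E n i j ⊗ₖ E n j i else 0)
  + ((r - s) * z / (z * r - s)) •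
      (∑ i ∈ Icc 1 (2*n), ∑ j ∈ Icc (i+1) (2*n), if i ≠ 2*n + 1 - j then E n i j ⊗ₖ E n j i else 0)
  + (1 / ((z - r⁻¹ * s) * (z - nExp n))) •
      (∑ i ∈ Icc 1 (2*n), ∑ j ∈ Icc 1 (2*n), aC n z i j • (E n (2*n+1-i) (2*n+1-j) ⊗ₖ E n i j))

def Qv : K := r⁻¹ * s
def tv : K := ρ * σ'⁻¹

def qf (n i j : ℕ) : K := tv ^ (bar n i - bar n j) * sg n i * sg n j

def Nf (n : ℕ) (z : K) (i j : ℕ) : K :=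
  (z - 1) / (z - Qv) * (if j = i then 1 else 0)
  + (1 - Qv) / (z - Qv) * (if n < i then z else 1) * (if j = 2 * n + 1 - i then 1 else 0)
  + (Qv - 1) * (z - 1) / ((z - Qv) * (z - nExp n)) * qf n i j * (if j ≤ i then z else nExp n)

theorem alg_ne (p : MvPolynomial (Fin 3) ℚ) (h : MvPolynomial.eval ![1, 0, 1] p ≠ 0) :
    algebraMap (MvPolynomial (Fin 3) ℚ) K p ≠ 0 := by
  intro h0
  have : p = 0 := (IsFractionRing.injective (MvPolynomial (Fin 3) ℚ) K) (by rw [h0, map_zero])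
  exact h (by rw [this, map_zero])

theorem rho_ne : ρ ≠ 0 := alg_ne _ (by simp)
theorem sig_ne : σ' ≠ 0 := by
  intro h0
  have := (IsFractionRing.injective (MvPolynomial (Fin 3) ℚ) K)
    (a₁ := MvPolynomial.X 1) (a₂ := 0) (by rw [map_zero]; exact h0)
  exact MvPolynomial.X_ne_zero _ this
theorem z_ne : zVar ≠ 0 := alg_ne _ (by simp)
theorem ne1 (m : ℕ) (hm : m ≠ 0) : zVar * r ^ m - s ^ m ≠ 0 := by
  have := alg_ne (MvPolynomial.X 2 * (MvPolynomial.X 0 ^ 2) ^ m - (MvPolynomial.X 1 ^ 2) ^ m)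
    (by simp [hm])
  simpa [zVar, r, s, ρ, σ'] using this
theorem ne2 (m : ℕ) (hm : m ≠ 0) : r ^ m - zVar * s ^ m ≠ 0 := by
  have := alg_ne ((MvPolynomial.X 0 ^ 2) ^ m - MvPolynomial.X 2 * (MvPolynomial.X 1 ^ 2) ^ m)
    (by simp [hm])
  simpa [zVar, r, s, ρ, σ'] using this
theorem ne3 : r - s ≠ 0 := by
  have := alg_ne ((MvPolynomial.X 0 ^ 2) - (MvPolynomial.X 1 ^ 2))
    (by simp)
  simpa [zVar, r, s, ρ, σ'] using this

theorem r_ne : r ≠ 0 := pow_ne_zero _ rho_ne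
theorem s_ne : s ≠ 0 := pow_ne_zero _ sig_ne
theorem Q_ne : Qv ≠ 0 := mul_ne_zero (inv_ne_zero r_ne) s_ne
theorem t_ne : tv ≠ 0 := mul_ne_zero rho_ne (inv_ne_zero sig_ne)
theorem Q_ne_one : 1 - Qv ≠ 0 := by
  have : 1 - Qv = (r - s) / r := by unfold Qv; field_simp [r_ne]
  rw [this]; exact div_ne_zero ne3 r_ne
theorem Q_eq : Qv = tv ^ (-2 : ℤ) := by
  unfold Qv tv r s
  have := rho_ne; have := sig_ne
  rw [show (-2 : ℤ) = -((2 : ℕ) : ℤ) from rfl, zpow_neg, zpow_natCast]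
  field_simp
theorem nExp_eq (n : ℕ) : nExp n = Qv ^ (n + 1) := by
  unfold nExp Qv
  rw [show -(n : ℤ) - 1 = -((n + 1 : ℕ) : ℤ) by push_cast; ring,
    show (n : ℤ) + 1 = ((n + 1 : ℕ) : ℤ) by push_cast; ring, zpow_neg, zpow_natCast, zpow_natCast,
    mul_pow, inv_pow]
theorem nExp_ne (n : ℕ) : nExp n ≠ 0 := by rw [nExp_eq]; exact pow_ne_zero _ Q_ne

theorem ne_zQ (m : ℕ) (hm : m ≠ 0) : zVar - Qv ^ m ≠ 0 := by
  have : zVar - Qv ^ m = (zVar * r ^ m - s ^ m) / r ^ m := by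
    have := r_ne
    unfold Qv; rw [mul_pow, inv_pow]; field_simp
  rw [this]; exact div_ne_zero (ne1 m hm) (pow_ne_zero _ r_ne)
theorem ne_zQ' (m : ℕ) (hm : m ≠ 0) : 1 - zVar * Qv ^ m ≠ 0 := by
  have : 1 - zVar * Qv ^ m = (r ^ m - zVar * s ^ m) / r ^ m := by
    have := r_ne
    unfold Qv; rw [mul_pow, inv_pow]; field_simp
  rw [this]; exact div_ne_zero (ne2 m hm) (pow_ne_zero _ r_ne)

theorem sg_sq (n i : ℕ) : sg n i * sg n i = 1 := by unfold sg; split_ifs <;> simp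
theorem sg_rev (n i : ℕ) (hi : 1 ≤ i) (hi2 : i ≤ 2 * n) : sg n (2 * n + 1 - i) = - sg n i := by
  unfold sg; split_ifs <;> first | omega | simp
theorem bar_rev (n i : ℕ) (hi : 1 ≤ i) (hi2 : i ≤ 2 * n) : bar n (2 * n + 1 - i) = - bar n i := by
  unfold bar; split_ifs <;> omega

theorem Qpow (k : ℤ) : Qv ^ k = tv ^ (-2 * k) := by rw [Q_eq, ← zpow_mul]

theorem qf_self (n i : ℕ) : qf n i i = 1 := by
  unfold qf; rw [sub_self, zpow_zero, one_mul, sg_sq]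

theorem qf_rev_left (n i j : ℕ) (hi : 1 ≤ i) (hi2 : i ≤ 2 * n) :
    qf n (2 * n + 1 - i) j = - (qf n i j * Qv ^ bar n i) := by
  unfold qf
  rw [sg_rev n i hi hi2, bar_rev n i hi hi2, Qpow,
    show - bar n i - bar n j = (bar n i - bar n j) + (-2 * bar n i) by ring, zpow_add₀ t_ne]
  ring
theorem qf_rev_right (n i j : ℕ) (hi : 1 ≤ j) (hi2 : j ≤ 2 * n) :
    qf n i (2 * n + 1 - j) = - (qf n i j * Qv ^ (- bar n j)) := by
  unfold qf
  rw [sg_rev n j hi hi2, bar_rev n j hi hi2, Qpow,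
    show bar n i - - bar n j = (bar n i - bar n j) + (-2 * - bar n j) by ring, zpow_add₀ t_ne]
  ring
theorem qf_mul (n i j k : ℕ) : qf n i j * qf n j k = qf n i k := by
  unfold qf
  rw [show bar n i - bar n k = (bar n i - bar n j) + (bar n j - bar n k) by ring, zpow_add₀ t_ne]
  linear_combination (tv ^ (bar n i - bar n j) * tv ^ (bar n j - bar n k)  * sg n i * sg n k) * sg_sq n j

theorem Gsum (n m : ℕ) : ∑ e ∈ Icc 1 m, Qv ^ bar n e =
    (Qv ^ bar n m - nExp n) / (1 - Qv) - (if n < m then 1 else 0) := by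
  have hQ := Q_ne_one
  induction m with
  | zero =>
    have : bar n 0 = ((n + 1 : ℕ) : ℤ) := by simp [bar]
    rw [this, zpow_natCast, nExp_eq]; simp
  | succ m ih =>
    rw [Finset.sum_Icc_succ_top (by omega), ih]
    rcases lt_trichotomy m n with h | h | h
    · have : bar n m = bar n (m + 1) + 1 := by unfold bar; split_ifs <;> omega
      rw [this, zpow_add₀ Q_ne, if_neg (by omega), if_neg (by omega)]
      field_simp
      ring
    · have h1 : bar n m = 1 := by unfold bar; split_ifs <;> omega
      have h2 : bar n (m + 1) = -1 := by unfold bar; split_ifs <;> omega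
      have := Q_ne
      rw [h1, h2, if_neg (by omega), if_pos (by omega)]
      simp only [zpow_one, zpow_neg_one]
      field_simp
      ring
    · have : bar n m = bar n (m + 1) + 1 := by unfold bar; split_ifs <;> omega
      rw [this, zpow_add₀ Q_ne, if_pos (by omega), if_pos (by omega)]
      field_simp
      ring

theorem Gsum_le (n a : ℕ) (ha : a ≤ 2 * n) :
    ∑ e ∈ Icc 1 (2 * n), Qv ^ bar n e * (if e ≤ a then 1 else 0) =
    (Qv ^ bar n a - nExp n) / (1 - Qv) - (if n < a then 1 else 0) := by
  rw [← Gsum]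
  simp only [mul_ite, mul_one, mul_zero]
  rw [← Finset.sum_filter]
  apply Finset.sum_congr _ (fun _ _ => rfl)
  ext e; simp only [Finset.mem_filter, Finset.mem_Icc]; omega

theorem sum_delta (n a : ℕ) (ha : 1 ≤ a) (ha2 : a ≤ 2 * n) (f : ℕ → K) :
    ∑ e ∈ Icc 1 (2 * n), (if e = a then 1 else 0) * f e = f a := by
  simp [Finset.sum_ite_eq']
  omega

theorem core1 (n : ℕ) (z w : K) (i d : ℕ) (hi : 1 ≤ i) (hi2 : i ≤ 2 * n) (hd : 1 ≤ d)
    (hd2 : d ≤ 2 * n) :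
    ∑ e ∈ Icc 1 (2 * n), qf n i e * (if e ≤ i then z else nExp n) *
      (qf n (2 * n + 1 - e) d * (if d ≤ 2 * n + 1 - e then w else nExp n)) =
    - qf n i d * (nExp n ^ 2 * (∑ e ∈ Icc 1 (2 * n), Qv ^ bar n e * (if e ≤ 2 * n then 1 else 0))
      + nExp n * (z - nExp n) * (∑ e ∈ Icc 1 (2 * n), Qv ^ bar n e * (if e ≤ i then 1 else 0))
      + nExp n * (w - nExp n) *
        (∑ e ∈ Icc 1 (2 * n), Qv ^ bar n e * (if e ≤ 2 * n + 1 - d then 1 else 0))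
      + (z - nExp n) * (w - nExp n) *
        (∑ e ∈ Icc 1 (2 * n), Qv ^ bar n e * (if e ≤ min i (2 * n + 1 - d) then 1 else 0))) := by
  simp only [Finset.mul_sum, ← Finset.sum_add_distrib]
  apply Finset.sum_congr rfl
  intro e he
  rw [Finset.mem_Icc] at he
  rw [qf_rev_left n e d he.1 he.2, ← qf_mul n i e d, if_pos he.2]
  by_cases h1 : e ≤ i <;> by_cases h2 : d ≤ 2 * n + 1 - e
  · rw [if_pos h1, if_pos h2, if_pos h1, if_pos (by omega), if_pos (by omega)]; ring
  · rw [if_pos h1, if_neg h2, if_pos h1, if_neg (by omega), if_neg (by omega)]; ring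
  · rw [if_neg h1, if_pos h2, if_neg h1, if_pos (by omega), if_neg (by omega)]; ring
  · rw [if_neg h1, if_neg h2, if_neg h1, if_neg (by omega), if_neg (by omega)]; ring

theorem core2 (n : ℕ) (z w : K) (i d : ℕ) (hi : 1 ≤ i) (hi2 : i ≤ 2 * n) (hd : 1 ≤ d)
    (hd2 : d ≤ 2 * n) :
    ∑ e ∈ Icc 1 (2 * n), Nf n z i e * Nf n w (2 * n + 1 - e) d =
    (z - 1) / (z - Qv) * Nf n w (2 * n + 1 - i) d
    + (1 - Qv) / (z - Qv) * (if n < i then z else 1) * Nf n w i d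
    + (Qv - 1) * (z - 1) / ((z - Qv) * (z - nExp n)) *
     (qf n i (2 * n + 1 - d) * (if 2 * n + 1 - d ≤ i then z else nExp n) * ((w - 1) / (w - Qv))
      + qf n i d * (if d ≤ i then z else nExp n) *
        ((1 - Qv) / (w - Qv) * (if d ≤ n then w else 1))
      + (Qv - 1) * (w - 1) / ((w - Qv) * (w - nExp n)) *
        ∑ e ∈ Icc 1 (2 * n), qf n i e * (if e ≤ i then z else nExp n) *
      (qf n (2 * n + 1 - e) d * (if d ≤ 2 * n + 1 - e then w else nExp n))) := by
  have e1 := sum_delta n i hi hi2 (fun e => Nf n w (2 * n + 1 - e) d)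
  have e2 := sum_delta n (2 * n + 1 - i) (by omega) (by omega)
    (fun e => Nf n w (2 * n + 1 - e) d)
  have e3 := sum_delta n (2 * n + 1 - d) (by omega) (by omega)
    (fun e => qf n i e * (if e ≤ i then z else nExp n))
  have e4 := sum_delta n d hd hd2
    (fun e => qf n i e * (if e ≤ i then z else nExp n))
  beta_reduce at e1 e2 e3 e4
  rw [show 2 * n + 1 - (2 * n + 1 - i) = i by omega] at e2
  rw [← e1, ← e2, ← e3, ← e4]
  simp only [Finset.mul_sum, Finset.sum_mul, ← Finset.sum_add_distrib]
  apply Finset.sum_congr rfl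
  intro e he
  rw [Finset.mem_Icc] at he
  have k1 : (if d = 2 * n + 1 - e then (1 : K) else 0) = if e = 2 * n + 1 - d then 1 else 0 :=
    if_congr (by omega) rfl rfl
  have k2 : (if d = 2 * n + 1 - (2 * n + 1 - e) then (1 : K) else 0) = if e = d then 1 else 0 :=
    if_congr (by omega) rfl rfl
  have k3 : (if e = d then (1 : K) else 0) * (if n < 2 * n + 1 - e then w else 1) =
      (if e = d then 1 else 0) * (if d ≤ n then w else 1) := by
    by_cases h : e = d
    · subst h; congr 1; exact if_congr (by omega) rfl rfl
    · simp [h]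
  generalize hN : Nf n w (2 * n + 1 - e) d = N
  rw [show Nf n z i e = (z - 1) / (z - Qv) * (if e = i then 1 else 0)
  + (1 - Qv) / (z - Qv) * (if n < i then z else 1) * (if e = 2 * n + 1 - i then 1 else 0)
  + (Qv - 1) * (z - 1) / ((z - Qv) * (z - nExp n)) * qf n i e * (if e ≤ i then z else nExp n)
   from rfl]
  have hN2 : N = (w - 1) / (w - Qv) * (if e = 2 * n + 1 - d then 1 else 0)
    + (1 - Qv) / (w - Qv) * ((if e = d then 1 else 0) * (if d ≤ n then w else 1))
    + (Qv - 1) * (w - 1) / ((w - Qv) * (w - nExp n)) *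
       (qf n (2 * n + 1 - e) d * (if d ≤ 2 * n + 1 - e then w else nExp n)) := by
    rw [← hN, Nf, k1, k2, ← k3]; ring
  generalize (Qv - 1) * (z - 1) / ((z - Qv) * (z - nExp n)) = C at *
  generalize (Qv - 1) * (w - 1) / ((w - Qv) * (w - nExp n)) = C' at *
  generalize (1 - Qv) / (z - Qv) = B at *
  generalize (1 - Qv) / (w - Qv) = B' at *
  generalize (z - 1) / (z - Qv) = A at *
  generalize (w - 1) / (w - Qv) = A' at *
  linear_combination (C * qf n i e * (if e ≤ i then z else nExp n)) * hN2

set_option maxHeartbeats 4000000 in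
theorem fld {F : Type*} [Field F] (z Q x X Y q : F) (p1 p2 a b c d : Prop) [Decidable p1]
    [Decidable p2] [Decidable a] [Decidable b] [Decidable c] [Decidable d]
    (hz : z ≠ 0) (hQ : Q ≠ 0) (hx : x ≠ 0) (hX : X ≠ 0) (hY : Y ≠ 0) (hQ1 : 1 - Q ≠ 0)
    (h1 : z - Q ≠ 0) (h2 : z - x ≠ 0) (h3 : 1 - z * Q ≠ 0) (h4 : 1 - z * x ≠ 0)
    (hp1 : p1 → q = 1 ∧ Y = X⁻¹ ∧ c ∧ (a ↔ ¬ b) ∧ (d ↔ a) ∧ ¬ p2)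
    (hp2 : p2 → q = - X⁻¹ ∧ Y = X ∧ d ∧ (a ↔ b) ∧ (c ↔ a) ∧ ¬ p1)
    (hcd : ¬ p1 → ¬ p2 → (c → d → a) ∧ (¬ c → ¬ d → ¬ a) ∧ (c → ¬ d → b) ∧ (¬ c → d → ¬ b)) :
    (z - 1) / (z - Q) * ((1 - z) / (1 - z * Q) * (if p2 then 1 else 0)
       + (1 - Q) * z / (1 - z * Q) * (if a then 1 else z⁻¹) * (if p1 then 1 else 0)
       + (Q - 1) * (1 - z) * z / ((1 - z * Q) * (1 - z * x)) * (-(q * X)) *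
          (if p2 ∨ ¬ d then z⁻¹ else x))
    + (1 - Q) / (z - Q) * (if a then z else 1) * ((1 - z) / (1 - z * Q) * (if p1 then 1 else 0)
       + (1 - Q) * z / (1 - z * Q) * (if a then z⁻¹ else 1) * (if p2 then 1 else 0)
       + (Q - 1) * (1 - z) * z / ((1 - z * Q) * (1 - z * x)) * q * (if c then z⁻¹ else x))
    + (Q - 1) * (z - 1) / ((z - Q) * (z - x)) *
     (-(q * Y) * (if d then z else x) * ((1 - z) / (1 - z * Q))
      + q * (if c then z else x) *
        ((1 - Q) * z / (1 - z * Q) * (if b then z⁻¹ else 1))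
      + (Q - 1) * (1 - z) * z / ((1 - z * Q) * (1 - z * x)) *
       (-q * (x ^ 2 * ((Q / x - x) / (1 - Q) - 1)
      + x * (z - x) * ((X - x) / (1 - Q) - if a then 1 else 0)
      + x * (z⁻¹ - x) * ((Y - x) / (1 - Q) - if b then 1 else 0)
      + (z - x) * (z⁻¹ - x) * (((if d then Y else X) - x) / (1 - Q) - if a ∧ b then 1 else 0))))
    = if p2 then 1 else 0 := by
  by_cases hh1 : p1
  · obtain ⟨e1, e2, e3, e4, e5, e6⟩ := hp1 hh1
    subst e1 e2
    by_cases ha : a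
    · have hb : ¬ b := e4.1 ha
      have hd : d := e5.2 ha
      simp only [hh1, ha, hb, hd, e3, e6, if_true, if_false, not_true, or_false, and_false]
      field_simp
      ring
    · have hb : b := by tauto
      have hd : ¬ d := by tauto
      simp only [hh1, ha, hb, hd, e3, e6, if_true, if_false, not_true, or_false, not_false_iff,
        or_true, false_and]
      field_simp
      ring
  · by_cases hh2 : p2
    · obtain ⟨e1, e2, e3, e4, e5, e6⟩ := hp2 hh2
      subst e1 e2
      by_cases ha : a
      · have hb : b := e4.1 ha
        have hc : c := e5.2 ha
        simp only [hh1, hh2, ha, hb, hc, e3, if_true, if_false, true_or, true_and]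
        field_simp
        ring
      · have hb : ¬ b := by tauto
        have hc : ¬ c := by tauto
        simp only [hh1, hh2, ha, hb, hc, e3, if_true, if_false, true_or, false_and]
        field_simp
        ring
    · obtain ⟨k1, k2, k3, k4⟩ := hcd hh1 hh2
      clear hp1 hp2 hcd
      by_cases hc : c <;> by_cases hd : d
      · have ha := k1 hc hd
        by_cases hb : b <;>
        · simp only [hh1, hh2, ha, hb, hc, hd, if_true, if_false, false_or, true_and, not_true]
          field_simp
          ring
      · have hb := k3 hc hd
        by_cases ha : a <;>
        · simp only [hh1, hh2, ha, hb, hc, hd, if_true, if_false, false_or, true_and, and_true,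
            not_false_iff]
          field_simp
          ring
      · have hb := k4 hc hd
        by_cases ha : a <;>
        · simp only [hh1, hh2, ha, hb, hc, hd, if_true, if_false, false_or, and_false,
            not_true]
          field_simp
          ring
      · have ha := k2 hc hd
        by_cases hb : b <;>
        · simp only [hh1, hh2, ha, hb, hc, hd, if_true, if_false, false_or, false_and,
            not_false_iff]
          field_simp
          ring

theorem bar_2n (n : ℕ) (hn : 2 ≤ n) : Qv ^ bar n (2 * n) = Qv / nExp n := by
  have : bar n (2 * n) = 1 - ((n + 1 : ℕ) : ℤ) := by unfold bar; split_ifs <;> push_cast <;> omega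
  rw [this, zpow_sub₀ Q_ne, zpow_one, zpow_natCast, nExp_eq]

theorem w1 (n : ℕ) : (zVar⁻¹ - 1) / (zVar⁻¹ - Qv) = (1 - zVar) / (1 - zVar * Qv) := by
  have h := z_ne
  rw [← mul_div_mul_left _ _ h, mul_sub, mul_sub, mul_inv_cancel₀ h, mul_one]
theorem w2 (n : ℕ) : (1 - Qv) / (zVar⁻¹ - Qv) = (1 - Qv) * zVar / (1 - zVar * Qv) := by
  have h := z_ne
  rw [← mul_div_mul_left _ _ h, mul_sub zVar zVar⁻¹, mul_inv_cancel₀ h, mul_comm zVar (1 - Qv)]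
theorem w3 (n : ℕ) : (Qv - 1) * (zVar⁻¹ - 1) / ((zVar⁻¹ - Qv) * (zVar⁻¹ - nExp n))
    = (Qv - 1) * (1 - zVar) * zVar / ((1 - zVar * Qv) * (1 - zVar * nExp n)) := by
  have h := z_ne
  rw [← mul_div_mul_left _ _ (mul_ne_zero h h)]
  congr 1
  · linear_combination (zVar * (Qv - 1)) * mul_inv_cancel₀ h
  · linear_combination (zVar * zVar⁻¹ + 1 - zVar * nExp n - zVar * Qv) * mul_inv_cancel₀ h

theorem core3 (n : ℕ) (hn : 2 ≤ n) (i d : ℕ) (hi : 1 ≤ i) (hi2 : i ≤ 2 * n) (hd : 1 ≤ d)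
    (hd2 : d ≤ 2 * n) :
    ∑ e ∈ Icc 1 (2 * n), Nf n zVar i e * Nf n zVar⁻¹ (2 * n + 1 - e) d =
      if i + d = 2 * n + 1 then 1 else 0 := by
  have hY : bar n (2 * n + 1 - d) = - bar n d := bar_rev n d hd hd2
  rw [core2 n _ _ i d hi hi2 hd hd2, core1 n _ _ i d hi hi2 hd hd2]
  rw [Gsum_le _ _ le_rfl, Gsum_le _ _ hi2, Gsum_le _ _ (by omega), Gsum_le _ _ (by omega)]
  unfold Nf
  rw [qf_rev_left n i d hi hi2, qf_rev_right n i d hd hd2, w1 n, w2 n, w3 n, bar_2n n hn, hY]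
  rw [← fld zVar Qv (nExp n) (Qv ^ bar n i) (Qv ^ (- bar n d)) (qf n i d) (i = d)
    (i + d = 2 * n + 1) (n < i) (d ≤ n) (d ≤ i) (2 * n + 1 ≤ i + d) z_ne Q_ne (nExp_ne n)
    (zpow_ne_zero _ Q_ne) (zpow_ne_zero _ Q_ne) Q_ne_one (by simpa using ne_zQ 1 (by norm_num))
    (by rw [nExp_eq]; exact ne_zQ _ (by omega)) (by simpa using ne_zQ' 1 (by norm_num))
    (by rw [nExp_eq]; exact ne_zQ' _ (by omega))
    (by
      intro h; subst h
      refine ⟨qf_self _ _, zpow_neg _ _, ?_⟩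
      omega)
    (by
      intro h
      have h' : i = 2 * n + 1 - d := by omega
      refine ⟨?_, ?_, ?_⟩
      · rw [h', qf_rev_left n d d hd hd2, qf_self, hY, zpow_neg, inv_inv, one_mul]
      · rw [h', hY]
      · omega)
    (by intro _ _; omega)]
  have hm : Qv ^ bar n (min i (2 * n + 1 - d)) =
      if 2 * n + 1 ≤ i + d then Qv ^ (- bar n d) else Qv ^ bar n i := by
    split_ifs with h
    · rw [min_eq_right (by omega), hY]
    · rw [min_eq_left (by omega)]
  rw [hm]
  have c1 : (d = 2 * n + 1 - i) = (i + d = 2 * n + 1) := propext (by omega)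
  have c2 : (d = 2 * n + 1 - (2 * n + 1 - i)) = (i = d) := propext (by omega)
  have c3 : (d = i) = (i = d) := propext (by omega)
  have c4 : (d ≤ 2 * n + 1 - i) = (i + d = 2 * n + 1 ∨ ¬ 2 * n + 1 ≤ i + d) := propext (by omega)
  have c5 : (2 * n + 1 - d ≤ i) = (2 * n + 1 ≤ i + d) := propext (by omega)
  have c6 : (n < 2 * n + 1 - d) = (d ≤ n) := propext (by omega)
  have c7 : (n < min i (2 * n + 1 - d)) = (n < i ∧ d ≤ n) := propext (by omega)
  have c8 : (n < 2 * n) = True := eq_true (by omega)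
  have c9 : (if n < 2 * n + 1 - i then zVar⁻¹ else 1) = if n < i then 1 else zVar⁻¹ := by
    split_ifs <;> first | rfl | omega
  rw [c9]
  simp only [c1, c2, c3, c4, c5, c6, c7, c8, if_true]

theorem aC_eq (n : ℕ) (z : K) (h1 : z - Qv ≠ 0) (h2 : z - nExp n ≠ 0) (i j : ℕ) (hi : 1 ≤ i)
    (hi2 : i ≤ 2 * n) (hj : 1 ≤ j) (hj2 : j ≤ 2 * n) :
    1 / ((z - r⁻¹ * s) * (z - nExp n)) * aC n z i j = Nf n z i j := by
  unfold aC Nf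
  have e1 : r⁻¹ * s = Qv := rfl
  have e2 : (ρ * σ'⁻¹) ^ (bar n i - bar n j) * sg n i * sg n j = qf n i j := rfl
  rw [e1, e2]
  by_cases h : i = j
  · subst h
    rw [if_pos rfl, if_pos rfl, if_neg (show ¬ (i = 2 * n + 1 - i) by omega), if_pos le_rfl, qf_self]
    generalize nExp n = x at *
    field_simp
    ring
  · rw [if_neg h, if_neg (Ne.symm h)]
    by_cases h' : j < i
    · rw [if_pos h', if_pos h'.le]
      by_cases hp : i = 2 * n + 1 - j
      · rw [if_pos hp, if_pos (by omega), if_pos (by omega)]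
        generalize nExp n = x at *
        field_simp
        ring
      · rw [if_neg hp, if_neg (show ¬ (j = 2 * n + 1 - i) by omega)]
        generalize nExp n = x at *
        field_simp
        ring
    · rw [if_neg h', if_neg (show ¬ (j ≤ i) by omega)]
      by_cases hp : i = 2 * n + 1 - j
      · rw [if_pos hp, if_pos (show (j = 2 * n + 1 - i) by omega), if_neg (by omega)]
        generalize nExp n = x at *
        field_simp
        ring
      · rw [if_neg hp, if_neg (show ¬ (j = 2 * n + 1 - i) by omega)]
        generalize nExp n = x at *
        field_simp
        ring

theorem dsum (S : Finset ℕ) (T : ℕ → Finset ℕ) (f : ℕ → ℕ → K) (x y : ℕ)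
    (h : ∀ i j, ¬ (i = x ∧ j = y) → f i j = 0) :
    ∑ i ∈ S, ∑ j ∈ T i, f i j = if x ∈ S ∧ y ∈ T x then f x y else 0 := by
  have h1 : ∀ i ∈ S, ∑ j ∈ T i, f i j = if i = x then (if y ∈ T x then f x y else 0) else 0 := by
    intro i _
    split_ifs with h1 h2
    · subst h1
      rw [Finset.sum_eq_single_of_mem y h2]
      intro j _ hj; exact h _ _ (by tauto)
    · subst h1
      apply Finset.sum_eq_zero
      intro j hj; apply h; rintro ⟨_, rfl⟩; exact h2 hj
    · apply Finset.sum_eq_zero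
      intro j hj; apply h; tauto
  rw [Finset.sum_congr rfl h1, Finset.sum_ite_eq']
  by_cases a : x ∈ S <;> by_cases b : y ∈ T x <;> simp [a, b]

theorem EE (n i j k l : ℕ) (a b c d : Fin (2 * n)) :
    (E n i j ⊗ₖ E n k l) (a, b) (c, d) =
    if (i = a.val + 1 ∧ k = b.val + 1) ∧ j = c.val + 1 ∧ l = d.val + 1 then 1 else 0 := by
  simp only [Matrix.kroneckerMap_apply, E, Matrix.of_apply]
  rw [ite_zero_mul_ite_zero, mul_one]
  exact if_congr (by omega) rfl rfl

theorem sumE1 (n : ℕ) (S : Finset ℕ) (T : ℕ → Finset ℕ) (a b c d : Fin (2 * n)) :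
    (∑ i ∈ S, ∑ j ∈ T i, E n i i ⊗ₖ E n j j) (a, b) (c, d) =
    if (a.val + 1 ∈ S ∧ b.val + 1 ∈ T (a.val + 1)) ∧ a = c ∧ b = d then 1 else 0 := by
  simp only [Matrix.sum_apply, EE]
  rw [dsum _ _ _ (a.val + 1) (b.val + 1)]
  · rw [← ite_and]
    exact if_congr (by simp [Fin.ext_iff]) rfl rfl
  · intro i j h; rw [if_neg]; tauto

theorem sumE2 (n : ℕ) (S : Finset ℕ) (T : ℕ → Finset ℕ) (a b c d : Fin (2 * n)) :
    (∑ i ∈ S, ∑ j ∈ T i, E n j j ⊗ₖ E n i i) (a, b) (c, d) =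
    if (b.val + 1 ∈ S ∧ a.val + 1 ∈ T (b.val + 1)) ∧ a = c ∧ b = d then 1 else 0 := by
  simp only [Matrix.sum_apply, EE]
  rw [dsum _ _ _ (b.val + 1) (a.val + 1)]
  · rw [← ite_and]
    exact if_congr (by simp [Fin.ext_iff]) rfl rfl
  · intro i j h; rw [if_neg]; tauto

theorem sumE3 (n : ℕ) (T : Finset ℕ) (a b c d : Fin (2 * n)) :
    (∑ j ∈ T, E n n n ⊗ₖ E n j j) (a, b) (c, d) =
    if (a.val + 1 ∈ ({n} : Finset ℕ) ∧ b.val + 1 ∈ T) ∧ a = c ∧ b = d then 1 else 0 := by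
  rw [← sumE1 n {n} (fun _ => T)]; simp
theorem sumE4 (n : ℕ) (T : Finset ℕ) (a b c d : Fin (2 * n)) :
    (∑ j ∈ T, E n j j ⊗ₖ E n n n) (a, b) (c, d) =
    if (b.val + 1 ∈ ({n} : Finset ℕ) ∧ a.val + 1 ∈ T) ∧ a = c ∧ b = d then 1 else 0 := by
  rw [← sumE2 n {n} (fun _ => T)]; simp

/-- positions (1-based) of the first diagonal sum -/
def cnd (n i j : ℕ) : Prop :=
  (i < j ∧ j ≤ n) ∨ (i ≤ n ∧ 2 * n + 2 ≤ i + j) ∨ (n + 1 ≤ j ∧ j < i) ∨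
    (j < n ∧ n + 1 ≤ i ∧ i + j ≤ 2 * n)

instance (n i j : ℕ) : Decidable (cnd n i j) := by unfold cnd; infer_instance

theorem five (P1 P2 P3 P4 P5 X C : Prop) [Decidable P1] [Decidable P2] [Decidable P3]
    [Decidable P4] [Decidable P5] [Decidable X] [Decidable C] 
    (h : C ↔ P1 ∨ P2 ∨ P3 ∨ P4 ∨ P5) (h12 : ¬ (P1 ∧ P2)) (h13 : ¬ (P1 ∧ P3))
    (h14 : ¬ (P1 ∧ P4)) (h15 : ¬ (P1 ∧ P5)) (h23 : ¬ (P2 ∧ P3)) (h24 : ¬ (P2 ∧ P4))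
    (h25 : ¬ (P2 ∧ P5)) (h34 : ¬ (P3 ∧ P4)) (h35 : ¬ (P3 ∧ P5)) (h45 : ¬ (P4 ∧ P5)) :
    (if P1 ∧ X then (1 : K) else 0) + (if P2 ∧ X then (1 : K) else 0)
    + (if P3 ∧ X then (1 : K) else 0) + (if P4 ∧ X then (1 : K) else 0)
    + (if P5 ∧ X then (1 : K) else 0) = if C ∧ X then 1 else 0 := by
  by_cases P1 <;> by_cases P2 <;> by_cases P3 <;> by_cases P4 <;> by_cases P5 <;> simp_all

theorem S1_apply (n : ℕ) (hn : 2 ≤ n) (a b c d : Fin (2 * n)) : S1 n (a, b) (c, d) =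
    if cnd n (a.val + 1) (b.val + 1) ∧ a = c ∧ b = d then 1 else 0 := by
  have := a.isLt; have := b.isLt
  unfold S1
  simp only [Matrix.add_apply, sumE1, sumE2, sumE3, sumE4, Finset.mem_Icc, Finset.mem_singleton]
  apply five
  · unfold cnd; omega
  all_goals omega

theorem S2_apply (n : ℕ) (hn : 2 ≤ n) (a b c d : Fin (2 * n)) : S2 n (a, b) (c, d) =
    if cnd n (b.val + 1) (a.val + 1) ∧ a = c ∧ b = d then 1 else 0 := by
  have := a.isLt; have := b.isLt
  unfold S2
  simp only [Matrix.add_apply, sumE1, sumE2, sumE3, sumE4, Finset.mem_Icc, Finset.mem_singleton]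
  apply five
  · unfold cnd; omega
  all_goals omega

theorem sumE5 (n : ℕ) (T : ℕ → Finset ℕ) (a b c d : Fin (2 * n)) :
    (∑ i ∈ Icc 1 (2 * n), ∑ j ∈ T i, if i ≠ 2*n + 1 - j then E n i j ⊗ₖ E n j i else 0)
      (a, b) (c, d) =
    if (b.val + 1 ∈ T (a.val + 1) ∧ a.val + b.val + 1 ≠ 2 * n) ∧ a = d ∧ b = c then 1 else 0 := by
  have := a.isLt; have := b.isLt
  have h0 : ∀ i j, (if i ≠ 2*n + 1 - j then E n i j ⊗ₖ E n j i else 0) (a, b) (c, d) =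
     if i ≠ 2*n + 1 - j then if (i = a.val + 1 ∧ j = b.val + 1) ∧ j = c.val + 1 ∧ i = d.val + 1
      then 1 else 0 else (0 : K) := by
    intro i j; rw [← EE]; split_ifs <;> rfl
  simp only [Matrix.sum_apply, h0]
  rw [dsum _ _ _ (a.val + 1) (b.val + 1)]
  · rw [← ite_and, ← ite_and]
    exact if_congr (by
      rw [Fin.ext_iff, Fin.ext_iff, Finset.mem_Icc]
      by_cases hp : b.val + 1 ∈ T (a.val + 1) <;>
        simp only [hp, true_and, and_true, false_and, and_false] <;> omega) rfl rfl
  · intro i j h; rw [if_neg (by tauto : ¬ ((i = a.val + 1 ∧ j = b.val + 1) ∧ j = c.val + 1 ∧ i = d.val + 1)), ite_self]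

theorem sumE6 (n : ℕ) (f : ℕ → ℕ → K) (a b c d : Fin (2 * n)) :
    (∑ i ∈ Icc 1 (2*n), ∑ j ∈ Icc 1 (2*n), f i j • (E n (2*n+1-i) (2*n+1-j) ⊗ₖ E n i j))
      (a, b) (c, d) =
    if a.val + b.val + 1 = 2 * n ∧ c.val + d.val + 1 = 2 * n then f (b.val + 1) (d.val + 1)
    else 0 := by
  have := a.isLt; have := b.isLt; have := c.isLt; have := d.isLt
  simp only [Matrix.sum_apply, Matrix.smul_apply, EE, smul_eq_mul]
  rw [dsum _ _ _ (b.val + 1) (d.val + 1)]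
  · rw [mul_ite, mul_one, mul_zero, ← ite_and]
    exact if_congr (by rw [Finset.mem_Icc, Finset.mem_Icc]; omega) rfl rfl
  · intro i j h; rw [if_neg (by omega), mul_zero]

theorem sumE0 (n : ℕ) (a b c d : Fin (2 * n)) :
    (∑ i ∈ Icc 1 (2*n), E n i i ⊗ₖ E n i i) (a, b) (c, d) =
    if a = b ∧ a = c ∧ b = d then 1 else 0 := by
  have h := sumE1 n (Icc 1 (2 * n)) (fun i => {i}) a b c d
  simp only [Finset.sum_singleton] at h
  rw [h]
  have := a.isLt
  exact if_congr (by rw [Finset.mem_singleton, Finset.mem_Icc, Fin.ext_iff, Fin.ext_iff, Fin.ext_iff]; omega) rfl rfl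

theorem P_apply (n : ℕ) (a b c d : Fin (2 * n)) :
    Pmat n (a, b) (c, d) = if a = d ∧ b = c then 1 else 0 := by
  have := a.isLt; have := b.isLt
  unfold Pmat
  simp only [Matrix.sum_apply, EE]
  rw [dsum _ _ _ (a.val + 1) (b.val + 1)]
  · rw [← ite_and]
    exact if_congr (by rw [Fin.ext_iff, Fin.ext_iff, Finset.mem_Icc, Finset.mem_Icc]; omega) rfl rfl
  · intro i j h; rw [if_neg]; tauto

theorem P_mul (n : ℕ) (A : M2 n) (a b : Fin (2 * n)) (x) :
    (Pmat n * A) (a, b) x = A (b, a) x := by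
  rw [Matrix.mul_apply, Fintype.sum_eq_single (b, a)]
  · rw [P_apply]; simp
  · rintro ⟨e, f⟩ h
    rw [P_apply, if_neg, zero_mul]
    rintro ⟨rfl, rfl⟩; exact h rfl
theorem mul_P (n : ℕ) (A : M2 n) (a b : Fin (2 * n)) (x) :
    (A * Pmat n) x (a, b) = A x (b, a) := by
  rw [Matrix.mul_apply, Fintype.sum_eq_single (b, a)]
  · rw [P_apply]; simp
  · rintro ⟨e, f⟩ h
    rw [P_apply, if_neg, mul_zero]
    rintro ⟨rfl, rfl⟩; exact h rfl

def Dg (n : ℕ) (z : K) (i j : ℕ) : K :=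
  if cnd n i j then r * s * (z - 1) / (z * r - s) else (z - 1) / (z * r - s)
def Og (z : K) (i j : ℕ) : K :=
  if j < i then (r - s) / (z * r - s) else (r - s) * z / (z * r - s)

theorem R_zero (n : ℕ) (hn : 2 ≤ n) (z : K) (h1 : z - Qv ≠ 0) (h2 : z - nExp n ≠ 0)
    (a b c d : Fin (2 * n)) (h : a.val + b.val + 1 = 2 * n) :
    Rbar n z (a, b) (c, d) =
      if c.val + d.val + 1 = 2 * n then Nf n z (b.val + 1) (d.val + 1) else 0 := by
  have := a.isLt; have := b.isLt; have := c.isLt; have := d.isLt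
  unfold Rbar
  simp only [Matrix.add_apply, Matrix.smul_apply, S1_apply n hn, S2_apply n hn, sumE0, sumE5,
    sumE6, smul_eq_mul]
  have e1 : ¬ cnd n (a.val + 1) (b.val + 1) := by unfold cnd; omega
  have e2 : ¬ cnd n (b.val + 1) (a.val + 1) := by unfold cnd; omega
  have e3 : ¬ (a = b ∧ a = c ∧ b = d) := by rintro ⟨h, _⟩; rw [Fin.ext_iff] at h; omega
  rw [if_neg e3]
  simp only [e1, e2, h, ne_eq, not_true, false_and, and_false, if_false, true_and, mul_zero,
    add_zero, zero_add]
  rw [mul_ite, mul_zero, aC_eq n z h1 h2] <;> omega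

theorem R_diag (n : ℕ) (hn : 2 ≤ n) (z : K) 
    (a b c d : Fin (2 * n)) (h : a = b) :
    Rbar n z (a, b) (c, d) = if c = a ∧ d = b then 1 else 0 := by
  subst h
  have := a.isLt; have := c.isLt; have := d.isLt
  unfold Rbar
  simp only [Matrix.add_apply, Matrix.smul_apply, S1_apply n hn, S2_apply n hn, sumE0, sumE5,
    sumE6, smul_eq_mul]
  have e1 : ¬ cnd n (a.val + 1) (a.val + 1) := by unfold cnd; omega
  have e3 : ¬ (a.val + a.val + 1 = 2 * n) := by omega
  have e4 : ¬ (a.val + 1 ∈ Icc 1 (a.val + 1 - 1)) := by rw [Finset.mem_Icc]; omega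
  have e5 : ¬ (a.val + 1 ∈ Icc (a.val + 1 + 1) (2 * n)) := by rw [Finset.mem_Icc]; omega
  simp only [e1, e3, e4, e5, false_and, if_false, true_and, mul_zero,
    add_zero, eq_comm]

theorem R_off (n : ℕ) (hn : 2 ≤ n) (z : K)
    (a b c d : Fin (2 * n)) (h : a.val + b.val + 1 ≠ 2 * n) (hab : a ≠ b) :
    Rbar n z (a, b) (c, d) = Dg n z (a.val + 1) (b.val + 1) * (if c = a ∧ d = b then 1 else 0)
      + Og z (a.val + 1) (b.val + 1) * (if c = b ∧ d = a then 1 else 0) := by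
  have := a.isLt; have := b.isLt; have := c.isLt; have := d.isLt
  have hab' : a.val ≠ b.val := fun h => hab (Fin.ext h)
  unfold Rbar Dg Og
  simp only [Matrix.add_apply, Matrix.smul_apply, S1_apply n hn, S2_apply n hn, sumE0, sumE5,
    sumE6, smul_eq_mul]
  have e4 : (b.val + 1 ∈ Icc 1 (a.val + 1 - 1)) ↔ b.val < a.val := by rw [Finset.mem_Icc]; omega
  have e5 : (b.val + 1 ∈ Icc (a.val + 1 + 1) (2 * n)) ↔ ¬ b.val < a.val := by
    rw [Finset.mem_Icc]; omega
  have e6 : b.val + 1 < a.val + 1 ↔ b.val < a.val := by omega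
  have e7 : cnd n (b.val + 1) (a.val + 1) ↔ ¬ cnd n (a.val + 1) (b.val + 1) := by
    unfold cnd; omega
  have e8 : (a = c ∧ b = d) ↔ (c = a ∧ d = b) := by rw [eq_comm, @eq_comm _ b]
  have e9 : (a = d ∧ b = c) ↔ (c = b ∧ d = a) := by rw [eq_comm, @eq_comm _ b, and_comm]
  simp only [e4, e5, e6, e7, e8, e9, h, hab, ne_eq, not_false_iff, and_true, false_and, if_false,
    mul_zero, add_zero, zero_add]
  by_cases k1 : cnd n (a.val + 1) (b.val + 1) <;> by_cases k2 : b.val < a.val <;>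
    simp only [k1, k2, not_true, not_false_iff, true_and, false_and, if_true, if_false, mul_zero,
      add_zero, zero_add]

theorem sc1 {F : Type*} [Field F] (z r s : F) (hz : z ≠ 0) (hr : r ≠ 0) (hs : s ≠ 0)
    (h1 : z * r - s ≠ 0) (h2 : r - z * s ≠ 0) :
    r * s * (z - 1) / (z * r - s) * ((z⁻¹ - 1) / (z⁻¹ * r - s))
      + (r - s) / (z * r - s) * ((r - s) / (z⁻¹ * r - s)) = 1 := by
  have e : z⁻¹ * r - s = (r - z * s) / z := by field_simp
  have e1 : (z⁻¹ - 1) / (z⁻¹ * r - s) = (1 - z) / (r - z * s) := by rw [e]; field_simp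
  have e2 : (r - s) / (z⁻¹ * r - s) = (r - s) * z / (r - z * s) := by rw [e]; field_simp
  rw [e1, e2, div_mul_div_comm, div_mul_div_comm, ← add_div,
    div_eq_one_iff_eq (mul_ne_zero h1 h2)]
  ring
theorem sc2 {F : Type*} [Field F] (z r s : F) (hz : z ≠ 0) (hr : r ≠ 0) (hs : s ≠ 0)
    (h1 : z * r - s ≠ 0) (h2 : r - z * s ≠ 0) (k : F) :
    k * (z - 1) / (z * r - s) * ((r - s) * z⁻¹ / (z⁻¹ * r - s))
      + (r - s) / (z * r - s) * (k * (z⁻¹ - 1) / (z⁻¹ * r - s)) = 0 := by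
  have e : z⁻¹ * r - s = (r - z * s) / z := by field_simp
  rw [e]; field_simp; ring
theorem sc3 {F : Type*} [Field F] (z r s : F) (hz : z ≠ 0) (hr : r ≠ 0) (hs : s ≠ 0)
    (h1 : z * r - s ≠ 0) (h2 : r - z * s ≠ 0) (k : F) :
    k * (z - 1) / (z * r - s) * ((r - s) / (z⁻¹ * r - s))
      + (r - s) * z / (z * r - s) * (k * (z⁻¹ - 1) / (z⁻¹ * r - s)) = 0 := by
  have e : z⁻¹ * r - s = (r - z * s) / z := by field_simp
  rw [e]; field_simp; ring

theorem DO1 (n i j : ℕ) (hij : i ≠ j) (hc : cnd n i j ↔ ¬ cnd n j i) :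
    Dg n zVar j i * Dg n zVar⁻¹ i j + Og zVar j i * Og zVar⁻¹ j i = 1 := by
  have h1 : zVar * r - s ≠ 0 := by simpa using ne1 1 (by norm_num)
  have h2 : r - zVar * s ≠ 0 := by simpa using ne2 1 (by norm_num)
  have key := sc1 zVar r s z_ne r_ne s_ne h1 h2
  have hz := mul_inv_cancel₀ z_ne
  have hd : Dg n zVar j i * Dg n zVar⁻¹ i j =
      r * s * (zVar - 1) / (zVar * r - s) * ((zVar⁻¹ - 1) / (zVar⁻¹ * r - s)) := by
    unfold Dg
    by_cases h : cnd n j i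
    · rw [if_pos h, if_neg (fun h2 => hc.1 h2 h)]
    · rw [if_neg h, if_pos (hc.2 h)]; ring
  have ho : Og zVar j i * Og zVar⁻¹ j i =
      (r - s) / (zVar * r - s) * ((r - s) / (zVar⁻¹ * r - s)) := by
    unfold Og
    split_ifs
    · rfl
    · rw [mul_div_assoc, mul_div_assoc, mul_div_assoc', mul_div_assoc' , div_mul_div_comm,
        div_mul_div_comm]
      congr 1
      linear_combination (r - s) ^ 2 * hz
  rw [hd, ho, key]

theorem DO2 (n i j : ℕ) (hij : i ≠ j) (hc : cnd n i j ↔ ¬ cnd n j i) :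
    Dg n zVar j i * Og zVar⁻¹ i j + Og zVar j i * Dg n zVar⁻¹ j i = 0 := by
  have h1 : zVar * r - s ≠ 0 := by simpa using ne1 1 (by norm_num)
  have h2 : r - zVar * s ≠ 0 := by simpa using ne2 1 (by norm_num)
  unfold Dg Og
  have k1 := sc2 zVar r s z_ne r_ne s_ne h1 h2 (r * s)
  have k2 := sc2 zVar r s z_ne r_ne s_ne h1 h2 1
  have k3 := sc3 zVar r s z_ne r_ne s_ne h1 h2 (r * s)
  have k4 := sc3 zVar r s z_ne r_ne s_ne h1 h2 1
  rw [one_mul, one_mul] at k2 k4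
  by_cases h : cnd n j i <;> by_cases h' : i < j
  · rw [if_pos h, if_neg (by omega), if_pos h', if_pos h]; exact k1
  · rw [if_pos h, if_pos (by omega), if_neg h', if_pos h]; exact k3
  · rw [if_neg h, if_neg (by omega), if_pos h', if_neg h]; exact k2
  · rw [if_neg h, if_pos (by omega), if_neg h', if_neg h]; exact k4

theorem hzQ : zVar - Qv ≠ 0 := by simpa using ne_zQ 1 (by norm_num)
theorem hzx (n : ℕ) : zVar - nExp n ≠ 0 := by rw [nExp_eq]; exact ne_zQ _ (by omega)
theorem inv_sub_ne (m : ℕ) (hm : m ≠ 0) : zVar⁻¹ - Qv ^ m ≠ 0 := by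
  intro h
  apply ne_zQ' m hm
  linear_combination zVar * h - mul_inv_cancel₀ z_ne
theorem hwQ : zVar⁻¹ - Qv ≠ 0 := by simpa using inv_sub_ne 1 (by norm_num)
theorem hwx (n : ℕ) : zVar⁻¹ - nExp n ≠ 0 := by rw [nExp_eq]; exact inv_sub_ne _ (by omega)

theorem unit1 (n : ℕ) (hn : 2 ≤ n) : (Pmat n * Rbar n zVar * Pmat n) * Rbar n zVar⁻¹ = 1 := by
  ext ⟨a, b⟩ ⟨c, d⟩
  have ha := a.isLt; have hb := b.isLt; have hc := c.isLt; have hd := d.isLt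
  rw [Matrix.mul_apply, Matrix.one_apply]
  have hP : ∀ x : Fin (2 * n) × Fin (2 * n), (Pmat n * Rbar n zVar * Pmat n) (a, b) x =
      Rbar n zVar (b, a) (x.2, x.1) := by
    rintro ⟨e, f⟩; rw [mul_P, P_mul]
  simp only [hP]
  by_cases h0 : a.val + b.val + 1 = 2 * n
  · have hR := fun x y => R_zero n hn zVar hzQ (hzx n) b a x y (by omega)
    rw [Fintype.sum_prod_type]
    have inner : ∀ e : Fin (2 * n), ∑ f, Rbar n zVar (b, a) (f, e) * Rbar n zVar⁻¹ (e, f) (c, d)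
        = (fun e : ℕ => Nf n zVar (a.val + 1) (e + 1) * (if c.val + d.val + 1 = 2 * n then
          Nf n zVar⁻¹ (2 * n + 1 - (e + 1)) (d.val + 1) else 0)) e.val := by
      intro e
      have he := e.isLt
      have hrev : e.rev.val = 2 * n - (e.val + 1) := Fin.val_rev e
      rw [Fintype.sum_eq_single e.rev]
      · rw [hR, R_zero n hn zVar⁻¹ hwQ (hwx n) _ _ _ _ (by omega), if_pos (by omega)]
        rw [show e.rev.val + 1 = 2 * n + 1 - (e.val + 1) by omega]
      · intro f hf
        rw [hR, if_neg, zero_mul]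
        intro hh; apply hf; apply Fin.ext; omega
    rw [Finset.sum_congr rfl (fun e _ => inner e), Fin.sum_univ_eq_sum_range
      (fun e : ℕ => Nf n zVar (a.val + 1) (e + 1) * (if c.val + d.val + 1 = 2 * n then
          Nf n zVar⁻¹ (2 * n + 1 - (e + 1)) (d.val + 1) else 0)), Finset.range_eq_Ico,
      Finset.sum_Ico_add' (fun e => Nf n zVar (a.val + 1) e * (if c.val + d.val + 1 = 2 * n then
          Nf n zVar⁻¹ (2 * n + 1 - e) (d.val + 1) else 0)) 0 (2 * n) 1]
    have hI : Ico (0 + 1) (2 * n + 1) = Icc 1 (2 * n) := by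
      ext x; rw [Finset.mem_Ico, Finset.mem_Icc]; omega
    rw [hI]
    by_cases hcd : c.val + d.val + 1 = 2 * n
    · simp only [hcd, if_true]
      rw [core3 n hn _ _ (by omega) (by omega) (by omega) (by omega)]
      exact if_congr (by rw [Prod.mk.injEq, Fin.ext_iff, Fin.ext_iff]; omega) rfl rfl
    · simp only [hcd, if_false, mul_zero, Finset.sum_const_zero]
      rw [if_neg]
      rw [Prod.mk.injEq, Fin.ext_iff, Fin.ext_iff]; omega
  · by_cases hab : a = b
    · subst hab
      rw [Fintype.sum_eq_single (a, a)]
      · rw [R_diag n hn _ _ _ _ _ rfl, R_diag n hn _ _ _ _ _ rfl, if_pos ⟨rfl, rfl⟩, one_mul]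
        exact if_congr (by rw [Prod.mk.injEq, eq_comm, @eq_comm _ d]) rfl rfl
      · rintro ⟨e, f⟩ h
        rw [R_diag n hn _ _ _ _ _ rfl, if_neg, zero_mul]
        rintro ⟨h1, h2⟩
        apply h; simp only at h1 h2; rw [h1, h2]
    · have hab' : a.val ≠ b.val := fun h => hab (Fin.ext h)
      have hR := fun x y => R_off n hn zVar b a x y (by omega) (Ne.symm hab)
      have e7 : cnd n (a.val + 1) (b.val + 1) ↔ ¬ cnd n (b.val + 1) (a.val + 1) := by
        unfold cnd; omega
      rw [Fintype.sum_eq_add (a, b) (b, a)]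
      · rw [hR, hR, R_off n hn _ a b c d h0 hab, R_off n hn _ b a c d (by omega) (Ne.symm hab)]
        have d1 := DO1 n (a.val + 1) (b.val + 1) (by omega) e7
        have d2 := DO2 n (a.val + 1) (b.val + 1) (by omega) e7
        have f1 : (if (a, b) = (c, d) then (1 : K) else 0) = if c = a ∧ d = b then 1 else 0 :=
          if_congr (by rw [Prod.mk.injEq, eq_comm, @eq_comm _ d]) rfl rfl
        rw [f1]
        simp only [hab, Ne.symm hab, and_self, if_true, if_false, mul_one, mul_zero, add_zero,
          zero_add]
        linear_combination (if c = a ∧ d = b then (1 : K) else 0) * d1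
          + (if c = b ∧ d = a then (1 : K) else 0) * d2
      · intro h; rw [Prod.mk.injEq] at h; exact hab h.1
      · rintro ⟨e, f⟩ ⟨h1, h2⟩
        rw [hR, if_neg, if_neg, mul_zero, mul_zero, add_zero, zero_mul]
        · rintro ⟨k1, k2⟩
          apply h2; simp only at k1 k2; rw [k1, k2]
        · rintro ⟨k1, k2⟩
          apply h1; simp only at k1 k2; rw [k1, k2]

/-- the unitarity condition for the affine `R`-matrix. -/
theorem stmt9 (n : ℕ) (hn : 2 ≤ n) :
    (Pmat n * Rbar n zVar * Pmat n) * Rbar n zVar⁻¹ = 1 ∧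
    Rbar n zVar⁻¹ * (Pmat n * Rbar n zVar * Pmat n) = 1 := by
  have h := unit1 n hn
  exact ⟨h, mul_eq_one_comm.mp h⟩

end
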